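/- Let r, ν > 0 and μ > (ν + 3)/2. Then the Turán-type inequality S_{μ,ν}^{(2,1)}(r, {n}) · S_{μ,ν}^{(2,3)}(r, {n}) ≥ (S_{μ,ν}^{(2,2)}(r, {n}))² holds. -/

import Mathlib

open Real

/-- The Cauchy–Schwarz inequality for the moments of a nonnegative weight. -/
theorem sq_tsum_mul_le_tsum_mul_tsum_sq {ι : Type*} {w x : ι → ℝ} (hw : ∀ i, 0 ≤ w i)
    (h0 : Summable w) (h1 : Summable fun i => w i * x i) (h2 : Summable fun i => w i * x i ^ 2) :
    (∑' i, w i * x i) ^ 2 ≤ (∑' i, w i) * ∑' i, w i * x i ^ 2 := by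
  have key : ∀ t : ℝ, 0 ≤ (∑' i, w i) * (t * t) + (-2 * ∑' i, w i * x i) * t +
      ∑' i, w i * x i ^ 2 := by
    intro t
    have hs := ((h0.hasSum.mul_right (t * t)).add
      ((h1.hasSum.mul_left (-2)).mul_right t)).add h2.hasSum
    refine hs.nonneg fun i => ?_
    have : w i * (t * t) + -2 * (w i * x i) * t + w i * x i ^ 2 = w i * (t - x i) ^ 2 := by ring
    rw [this]
    exact mul_nonneg (hw i) (sq_nonneg _)
  have := discrim_le_zero key
  unfold discrim at this
  linarith

theorem ascPochhammer_eval_eq_prod (ν : ℝ) (n : ℕ) :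
    (ascPochhammer ℝ n).eval ν = ∏ j ∈ Finset.range n, (ν + j) := by
  induction n with
  | zero => simp
  | succ n ih => rw [ascPochhammer_succ_eval, ih, Finset.prod_range_succ]

/-- The quotient `(ν)_n / n!` grows at most like `n ^ (ν - 1)`. -/
theorem eventually_ascPochhammer_eval_le {ν : ℝ} (hν : 0 < ν) :
    ∀ᶠ n : ℕ in Filter.atTop, (ascPochhammer ℝ n).eval ν ≤
      2 / Gamma ν * (n : ℝ) ^ (ν - 1) * (n.factorial : ℝ) := by
  have hG := Gamma_pos_of_pos hν
  filter_upwards [(GammaSeq_tendsto_Gamma ν).eventually (lt_mem_nhds (half_lt_self hG)),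
    Filter.eventually_gt_atTop 0] with n hn hn0
  have hn0' : (0 : ℝ) < n := by exact_mod_cast hn0
  have hP := ascPochhammer_pos n ν hν
  rw [GammaSeq, Finset.prod_range_succ, ← ascPochhammer_eval_eq_prod,
    lt_div_iff₀ (by positivity)] at hn
  have hpow : (n : ℝ) ^ ν = (n : ℝ) ^ (ν - 1) * n := by
    rw [rpow_sub_one hn0'.ne', div_mul_cancel₀ _ hn0'.ne']
  have h1 : Gamma ν / 2 * (ascPochhammer ℝ n).eval ν * n ≤
      (n : ℝ) ^ (ν - 1) * (n.factorial : ℝ) * n := by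
    have : 0 ≤ Gamma ν / 2 * (ascPochhammer ℝ n).eval ν * ν := by positivity
    rw [hpow] at hn
    linarith
  have h2 := le_of_mul_le_mul_right h1 hn0'
  have h3 : (ascPochhammer ℝ n).eval ν =
      2 / Gamma ν * (Gamma ν / 2 * (ascPochhammer ℝ n).eval ν) := by field_simp
  rw [h3, mul_assoc (2 / Gamma ν)]
  gcongr

theorem summable_mathieu_two_three {r μ ν : ℝ} (hν : 0 < ν) (hμ : (ν + 3) / 2 < μ) :
    Summable fun n : ℕ => 2 * (n : ℝ) ^ 3 * (ascPochhammer ℝ n).eval ν /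
      (((n : ℝ) ^ 2 + r ^ 2) ^ μ * (n.factorial : ℝ)) := by
  have hG := Gamma_pos_of_pos hν
  refine summable_of_isBigO_nat (g := fun n : ℕ => (n : ℝ) ^ (ν + 2 - 2 * μ))
    (summable_nat_rpow.2 (by linarith)) (.of_bound (4 / Gamma ν) ?_)
  filter_upwards [eventually_ascPochhammer_eval_le hν, Filter.eventually_gt_atTop 0] with n hn hn0
  have hn0' : (0 : ℝ) < n := by exact_mod_cast hn0
  have hP := ascPochhammer_pos n ν hν
  rw [norm_of_nonneg (by positivity), norm_of_nonneg (by positivity),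
    div_le_iff₀ (by positivity)]
  have hden : (n : ℝ) ^ (2 * μ) ≤ ((n : ℝ) ^ 2 + r ^ 2) ^ μ := by
    rw [rpow_mul hn0'.le, rpow_two]
    exact rpow_le_rpow (by positivity) (by nlinarith [sq_nonneg r]) (by linarith)
  have hexp : (n : ℝ) ^ 3 * (n : ℝ) ^ (ν - 1) =
      (n : ℝ) ^ (ν + 2 - 2 * μ) * (n : ℝ) ^ (2 * μ) := by
    rw [← rpow_natCast, ← rpow_add hn0', ← rpow_add hn0']
    congr 1
    push_cast
    ring
  calc 2 * (n : ℝ) ^ 3 * (ascPochhammer ℝ n).eval ν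
      ≤ 2 * (n : ℝ) ^ 3 * (2 / Gamma ν * (n : ℝ) ^ (ν - 1) * (n.factorial : ℝ)) := by gcongr
    _ = 4 / Gamma ν * ((n : ℝ) ^ 3 * (n : ℝ) ^ (ν - 1)) * (n.factorial : ℝ) := by ring
    _ = 4 / Gamma ν * (n : ℝ) ^ (ν + 2 - 2 * μ) * ((n : ℝ) ^ (2 * μ) * (n.factorial : ℝ)) := by
      rw [hexp]; ring
    _ ≤ _ := by gcongr

/-- Turán-type inequality
`S_{μ,ν}^{(2,1)}(r,{n}) · S_{μ,ν}^{(2,3)}(r,{n}) ≥ (S_{μ,ν}^{(2,2)}(r,{n}))²`, where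
`S_{μ,ν}^{(α,β)}(r,{n}) = ∑_{n≥1} 2 n^β (ν)_n / ((n^α + r²)^μ n!)`. -/
theorem mathieu_turan_inequality_21
    (r μ ν : ℝ) (hr : 0 < r) (hν : 0 < ν) (hμ : (ν + 3) / 2 < μ) :
    (∑' n : ℕ+, 2 * (n : ℝ) * (ascPochhammer ℝ (n : ℕ)).eval ν /
          (((n : ℝ) ^ 2 + r ^ 2) ^ μ * ((n : ℕ).factorial : ℝ))) *
        (∑' n : ℕ+, 2 * (n : ℝ) ^ 3 * (ascPochhammer ℝ (n : ℕ)).eval ν /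
          (((n : ℝ) ^ 2 + r ^ 2) ^ μ * ((n : ℕ).factorial : ℝ))) ≥
      (∑' n : ℕ+, 2 * (n : ℝ) ^ 2 * (ascPochhammer ℝ (n : ℕ)).eval ν /
          (((n : ℝ) ^ 2 + r ^ 2) ^ μ * ((n : ℕ).factorial : ℝ))) ^ 2 := by
  set w : ℕ+ → ℝ := fun n => 2 * (n : ℝ) * (ascPochhammer ℝ (n : ℕ)).eval ν /
    (((n : ℝ) ^ 2 + r ^ 2) ^ μ * ((n : ℕ).factorial : ℝ)) with hw
  have hw0 : ∀ n, 0 ≤ w n := fun n => by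
    have := ascPochhammer_pos (n : ℕ) ν hν
    positivity
  have e1 : ∀ n : ℕ+, 2 * (n : ℝ) ^ 2 * (ascPochhammer ℝ (n : ℕ)).eval ν /
      (((n : ℝ) ^ 2 + r ^ 2) ^ μ * ((n : ℕ).factorial : ℝ)) = w n * (n : ℝ) := fun n => by
    simp only [hw]; ring
  have e2 : ∀ n : ℕ+, 2 * (n : ℝ) ^ 3 * (ascPochhammer ℝ (n : ℕ)).eval ν /
      (((n : ℝ) ^ 2 + r ^ 2) ^ μ * ((n : ℕ).factorial : ℝ)) = w n * (n : ℝ) ^ 2 := fun n => by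
    simp only [hw]; ring
  have h1n : ∀ n : ℕ+, (1 : ℝ) ≤ (n : ℝ) := fun n => by exact_mod_cast n.pos
  have h2 : Summable fun n : ℕ+ => w n * (n : ℝ) ^ 2 :=
    ((summable_mathieu_two_three (r := r) hν hμ).comp_injective PNat.coe_injective).congr e2
  have h1 : Summable fun n : ℕ+ => w n * (n : ℝ) :=
    h2.of_nonneg_of_le (fun n => mul_nonneg (hw0 n) (by positivity)) fun n =>
      mul_le_mul_of_nonneg_left (by nlinarith [h1n n]) (hw0 n)
  have h0 : Summable w :=
    h1.of_nonneg_of_le hw0 fun n => le_mul_of_one_le_right (hw0 n) (h1n n)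
  simp only [e1, e2]
  exact sq_tsum_mul_le_tsum_mul_tsum_sq hw0 h0 h1 h2
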